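/- Let G be a finite multigraph and K a field of characteristic 0. The total dimension of B_G^{F_1} (the case t = 1) as a vector space over K equals the number of subforests of G. -/

import Mathlib

open MvPolynomial

namespace ForestAlg

variable {V E : Type*}

/-- Two vertices are directly connected by an edge of `A`. -/
def edgeRel (ends : E → Sym2 V) (A : Finset E) (v w : V) : Prop :=
  ∃ e ∈ A, ends e = s(v, w)

/-- Number of connected components of the spanning subgraph `(V, A)`. -/
noncomputable def numComponents (ends : E → Sym2 V) (A : Finset E) : ℕ :=
  Nat.card (Quot (edgeRel ends A))

/-- Rank `r(A) = v(G) - c(V,A)`. -/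
noncomputable def rank (ends : E → Sym2 V) (A : Finset E) : ℕ :=
  Nat.card V - numComponents ends A

/-- `A` is a subforest (contains no cycle): `|A| = v(G) - c(V,A)`. -/
def IsForest (ends : E → Sym2 V) (A : Finset E) : Prop :=
  A.card + numComponents ends A = Nat.card V

/-- The Tutte polynomial, evaluated at `(x, y)`. -/
noncomputable def tutte [Fintype E] {R : Type*} [CommRing R]
    (ends : E → Sym2 V) (x y : R) : R :=
  ∑ A ∈ (Finset.univ : Finset E).powerset,
    (x - 1) ^ (rank ends Finset.univ - rank ends A) *
      (y - 1) ^ (A.card - rank ends A)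

/-- `e ∉ F` is externally active for the subforest `F` with respect to the linear
order `o`: `F + e` contains a cycle and `e` is the minimal edge of that cycle
(the edges of the unique cycle of `F + e` are those whose removal does not
decrease the rank). -/
def ExtActive [DecidableEq E] (o : LinearOrder E) (ends : E → Sym2 V)
    (F : Finset E) (e : E) : Prop :=
  e ∉ F ∧ ¬ IsForest ends (insert e F) ∧
    ∀ f ∈ insert e F,
      rank ends ((insert e F).erase f) = rank ends (insert e F) → o.le e f

/-- External activity `act_G(F)`. -/
noncomputable def act [DecidableEq E] (o : LinearOrder E) (ends : E → Sym2 V)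
    (F : Finset E) : ℕ :=
  Set.ncard {e : E | ExtActive o ends F e}

/-- `D_I`: number of edges with one endpoint in `I` and the other outside `I`. -/
noncomputable def crossCount {n : ℕ} (ends : E → Sym2 (Fin n))
    (I : Finset (Fin n)) : ℕ :=
  Set.ncard {e : E | (∃ v ∈ ends e, v ∈ I) ∧ ∃ w ∈ ends e, w ∉ I}

/-- The ideal `J_G^{F_t}` generated by `(∑_{i ∈ I} x_i)^{t·D_I + 1}` over nonempty `I`. -/
noncomputable def forestIdeal (K : Type*) [Field K] {n : ℕ} (t : ℕ)
    (ends : E → Sym2 (Fin n)) : Ideal (MvPolynomial (Fin n) K) :=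
  Ideal.span {p | ∃ I : Finset (Fin n), I.Nonempty ∧
    p = (∑ i ∈ I, X i) ^ (t * crossCount ends I + 1)}

/-- The `k`-th graded component of `K[x_1,…,x_n]/J` (for homogeneous `J`):
the image of the degree-`k` homogeneous part in the quotient. -/
noncomputable def gradedPiece (K : Type*) [Field K] {n : ℕ}
    (J : Ideal (MvPolynomial (Fin n) K)) (k : ℕ) :
    Submodule K (MvPolynomial (Fin n) K ⧸ J) :=
  Submodule.map (Ideal.Quotient.mkₐ K J).toLinearMap
    (homogeneousSubmodule (Fin n) K k)

/-- Dimension of the `k`-th graded component of the quotient. -/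
noncomputable def gradedDim (K : Type*) [Field K] {n : ℕ}
    (J : Ideal (MvPolynomial (Fin n) K)) (k : ℕ) : ℕ :=
  Module.finrank K (gradedPiece K J k)


section EdgeLists

variable (K : Type*) [Field K]

/-- The derivation `∂/∂x_a - ∂/∂x_b` attached to the edge `p = (a, b)`. -/
noncomputable def edgeDeriv (p : V × V) :
    Derivation K (MvPolynomial V K) (MvPolynomial V K) :=
  pderiv p.1 - pderiv p.2

variable {K} in
lemma edgeDeriv_self (a : V) : edgeDeriv K (a, a) = 0 := by
  simp [edgeDeriv]

variable [DecidableEq V]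

/-- The number of edges of the list `l` with exactly one endpoint in `I`. -/
def cutSize (ends : E → V × V) (l : List E) (I : Finset V) : ℕ :=
  l.countP fun e => ¬((ends e).1 ∈ I ↔ (ends e).2 ∈ I)

/-- The ideal generated by the powers `(∑_{i ∈ I} x_i)^{D_I + 1}`, where `D_I` counts
the edges of the list `l`. -/
noncomputable def cutIdeal (ends : E → V × V) (l : List E) : Ideal (MvPolynomial V K) :=
  Ideal.span (Set.range fun I : Finset V => (∑ i ∈ I, X i) ^ (cutSize ends l I + 1))

/-- The polynomials all of whose iterated edge derivatives along sublists of `l`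
vanish at the origin. -/
def DerivVanish (ends : E → V × V) : List E → MvPolynomial V K → Prop
  | [], g => constantCoeff g = 0
  | e :: l, g => DerivVanish ends l g ∧ DerivVanish ends l (edgeDeriv K (ends e) g)

/-- The map of vertices identifying `b` with `a`. -/
def merge (a b : V) (v : V) : V := if v = b then a else v

/-- The substitution `x_k ↦ ∑_{m w = k} x_w`. -/
noncomputable def fiberSum [Fintype V] (m : V → V) :
    MvPolynomial V K →ₐ[K] MvPolynomial V K :=
  aeval fun k => ∑ w with m w = k, X w

variable {K}

lemma edgeDeriv_X (p : V × V) (v : V) :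
    edgeDeriv K p (X v) = C ((if v = p.1 then 1 else 0) - (if v = p.2 then 1 else 0)) := by
  rw [edgeDeriv, Derivation.sub_apply, pderiv_X, pderiv_X, Pi.single_apply, Pi.single_apply]
  split_ifs <;> simp

lemma edgeDeriv_sum_X (p : V × V) (I : Finset V) :
    edgeDeriv K p (∑ i ∈ I, X i) =
      C ((if p.1 ∈ I then 1 else 0) - (if p.2 ∈ I then 1 else 0)) := by
  simp only [map_sum, edgeDeriv_X, ← map_sum C, Finset.sum_sub_distrib]
  simp

lemma cutSize_cons (ends : E → V × V) (e : E) (l : List E) (I : Finset V) :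
    cutSize ends (e :: l) I = cutSize ends l I +
      if ((ends e).1 ∈ I ↔ (ends e).2 ∈ I) then 0 else 1 := by
  rw [cutSize, cutSize, List.countP_cons]
  by_cases h : ((ends e).1 ∈ I ↔ (ends e).2 ∈ I) <;> simp [h]

lemma pow_mem_cutIdeal (ends : E → V × V) (l : List E) (I : Finset V) {k : ℕ}
    (hk : cutSize ends l I + 1 ≤ k) :
    (∑ i ∈ I, X i : MvPolynomial V K) ^ k ∈ cutIdeal K ends l :=
  Ideal.mem_of_dvd _ (pow_dvd_pow _ hk) (Ideal.subset_span ⟨I, rfl⟩)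

lemma cutIdeal_cons_le (ends : E → V × V) (e : E) (l : List E) :
    cutIdeal K ends (e :: l) ≤ cutIdeal K ends l := by
  rw [cutIdeal, Ideal.span_le]
  rintro _ ⟨I, rfl⟩
  exact pow_mem_cutIdeal ends l I (by simp [cutSize_cons])

lemma cutIdeal_cons_of_loop (ends : E → V × V) (e : E) (l : List E)
    (he : (ends e).1 = (ends e).2) : cutIdeal K ends (e :: l) = cutIdeal K ends l := by
  simp only [cutIdeal, cutSize_cons, he, if_true, add_zero]

lemma edgeDeriv_mem_cutIdeal (ends : E → V × V) (e : E) (l : List E) {g : MvPolynomial V K}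
    (hg : g ∈ cutIdeal K ends (e :: l)) :
    edgeDeriv K (ends e) g ∈ cutIdeal K ends l := by
  induction hg using Submodule.closure_induction with
  | zero => simp
  | add x y _ _ hx hy => rw [map_add]; exact add_mem hx hy
  | smul_mem q x hx =>
    obtain ⟨I, rfl⟩ := hx
    rw [smul_eq_mul, Derivation.leibniz, Derivation.leibniz_pow, edgeDeriv_sum_X]
    refine add_mem ?_ (Ideal.mul_mem_right _ _ (pow_mem_cutIdeal ends l I ?_))
    · by_cases h : ((ends e).1 ∈ I ↔ (ends e).2 ∈ I)
      · simp [h]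
      · refine Ideal.mul_mem_left _ _ (Submodule.smul_of_tower_mem _ _
          (Ideal.mul_mem_right _ _ (pow_mem_cutIdeal ends l I ?_)))
        simp [cutSize_cons, h]
    · simp [cutSize_cons]

lemma exists_iterate_edgeDeriv_eq_zero (p : V × V) (q : MvPolynomial V K) :
    ∃ N : ℕ, (edgeDeriv K p)^[N] q = 0 := by
  have hX (v : V) (N : ℕ) : ∀ q, (edgeDeriv K p)^[N] q = 0 →
      (edgeDeriv K p)^[N + 1] (q * X v) = 0 := by
    induction N with
    | zero => intro q hq; simp_all
    | succ N ih =>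
      intro q hq
      rw [Function.iterate_succ_apply, Derivation.leibniz, edgeDeriv_X, iterate_map_add,
        smul_eq_mul, smul_eq_mul, mul_comm (X v), ih _ hq, mul_comm q, ← smul_eq_C_mul]
      have (c : K) (M : ℕ) (r : MvPolynomial V K) :
          (edgeDeriv K p)^[M] (c • r) = c • (edgeDeriv K p)^[M] r := by
        induction M generalizing r with
        | zero => rfl
        | succ M ih => simp only [Function.iterate_succ_apply, Derivation.map_smul, ih]
      rw [this, hq, smul_zero, add_zero]
  induction q using MvPolynomial.induction_on with
  | C c => exact ⟨1, by simp⟩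
  | add q r hq hr =>
    obtain ⟨M, hM⟩ := hq
    obtain ⟨N, hN⟩ := hr
    refine ⟨M + N, ?_⟩
    rw [iterate_map_add, Function.iterate_add_apply _ M N r, hN, add_comm M N,
      Function.iterate_add_apply, hM]
    simp
  | mul_X q v hq =>
    obtain ⟨N, hN⟩ := hq
    exact ⟨N + 1, hX v N q hN⟩

/-- Integration by parts. -/
lemma exists_edgeDeriv_eq_mul_pow [CharZero K] (p : V × V) {ℓ : MvPolynomial V K}
    (hℓ : edgeDeriv K p ℓ = 1) (q : MvPolynomial V K) (k : ℕ) :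
    ∃ h, edgeDeriv K p h = q * ℓ ^ k ∧ ℓ ^ (k + 1) ∣ h := by
  obtain ⟨N, hN⟩ := exists_iterate_edgeDeriv_eq_zero p q
  induction N generalizing q k with
  | zero => exact ⟨0, by simp_all⟩
  | succ N ih =>
    obtain ⟨h, hd, hdvd⟩ := ih (edgeDeriv K p q) (k + 1) hN
    have hk : ((k : K) + 1) ≠ 0 := by exact_mod_cast k.succ_ne_zero
    refine ⟨((k : K) + 1)⁻¹ • (q * ℓ ^ (k + 1) - h), ?_, ?_⟩
    · rw [Derivation.map_smul, map_sub, hd, Derivation.leibniz, Derivation.leibniz_pow, hℓ,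
        inv_smul_eq_iff₀ hk, smul_eq_C_mul]
      simp
      ring
    · rw [smul_eq_C_mul]
      exact Dvd.dvd.mul_left (dvd_sub (dvd_mul_left _ _)
        ((pow_dvd_pow _ (Nat.le_succ _)).trans hdvd)) _

lemma edgeDeriv_surjective [CharZero K] {a b : V} (hab : a ≠ b) :
    Function.Surjective (edgeDeriv K (a, b)) := fun q => by
  obtain ⟨h, hh, -⟩ := exists_edgeDeriv_eq_mul_pow (a, b) (ℓ := X a)
    (by simp [edgeDeriv_X, hab]) q 0
  exact ⟨h, by simpa using hh⟩

lemma exists_mem_cutIdeal_edgeDeriv_eq [CharZero K] (ends : E → V × V) (e : E) (l : List E)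
    (he : (ends e).1 ≠ (ends e).2) {g : MvPolynomial V K} (hg : g ∈ cutIdeal K ends l) :
    ∃ h ∈ cutIdeal K ends (e :: l), edgeDeriv K (ends e) h = g := by
  induction hg using Submodule.closure_induction with
  | zero => exact ⟨0, by simp⟩
  | add x y _ _ hx hy =>
    obtain ⟨u, hu, rfl⟩ := hx
    obtain ⟨v, hv, rfl⟩ := hy
    exact ⟨u + v, add_mem hu hv, map_add _ _ _⟩
  | smul_mem q x hx =>
    obtain ⟨I, rfl⟩ := hx
    by_cases h : ((ends e).1 ∈ I ↔ (ends e).2 ∈ I)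
    · obtain ⟨q, rfl⟩ := edgeDeriv_surjective he q
      refine ⟨q * (∑ i ∈ I, X i) ^ (cutSize ends l I + 1), Ideal.mul_mem_left _ _
        (pow_mem_cutIdeal ends _ I (by simp [cutSize_cons, h])), ?_⟩
      rw [Derivation.leibniz, Derivation.leibniz_pow, edgeDeriv_sum_X]
      simp [h, mul_comm]
    · obtain ⟨ε, hε, hd⟩ : ∃ ε : K, ε * ε = 1 ∧
          edgeDeriv K (ends e) (ε • ∑ i ∈ I, X i) = 1 := by
        simp only [Derivation.map_smul, edgeDeriv_sum_X]
        by_cases h1 : (ends e).1 ∈ I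
        · exact ⟨1, by simp, by simp_all⟩
        · exact ⟨-1, by simp, by simp_all⟩
      obtain ⟨u, hu, hdvd⟩ := exists_edgeDeriv_eq_mul_pow (ends e) hd
        (ε ^ (cutSize ends l I + 1) • q) (cutSize ends l I + 1)
      refine ⟨u, Ideal.mem_of_dvd _ hdvd ?_, ?_⟩
      · rw [smul_pow]
        exact Submodule.smul_of_tower_mem _ _
          (pow_mem_cutIdeal ends _ I (by simp [cutSize_cons, h]))
      · rw [hu, smul_pow, smul_mul_smul_comm, ← mul_pow, hε, one_pow, one_smul, smul_eq_mul]

lemma merge_left (a b : V) : merge a b a = a := by simp [merge]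

lemma merge_right (a b : V) : merge a b b = a := by simp [merge]

lemma merge_of_ne (a : V) {b v : V} (h : v ≠ b) : merge a b v = v := if_neg h

lemma merge_ne {a b : V} (hab : a ≠ b) (v : V) : merge a b v ≠ b := by
  unfold merge; split_ifs <;> assumption

section Contraction

variable [Fintype V]

lemma fiberSum_X (m : V → V) (k : V) :
    fiberSum K m (X k) = ∑ w with m w = k, X w := aeval_X _ _

lemma fiberSum_sum_X (m : V → V) (I : Finset V) :
    fiberSum K m (∑ i ∈ I, X i) = ∑ w with m w ∈ I, X w := by
  simp only [map_sum, fiberSum_X]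
  rw [Finset.sum_fiberwise_eq_sum_filter]

lemma edgeDeriv_fiberSum (m : V → V) (p : V × V) (h : MvPolynomial V K) :
    edgeDeriv K p (fiberSum K m h) = fiberSum K m (edgeDeriv K (Prod.map m m p) h) := by
  induction h using MvPolynomial.induction_on with
  | C c => simp [← algebraMap_eq]
  | add q r hq hr => simp only [map_add, hq, hr]
  | mul_X q v hq =>
    rw [map_mul, Derivation.leibniz, Derivation.leibniz, hq, fiberSum_X, edgeDeriv_sum_X,
      edgeDeriv_X]
    simp only [smul_eq_mul, map_add, map_mul, fiberSum_X, ← algebraMap_eq, AlgHom.commutes]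
    simp [eq_comm]

lemma constantCoeff_fiberSum (m : V → V) (h : MvPolynomial V K) :
    constantCoeff (fiberSum K m h) = constantCoeff h := by
  induction h using MvPolynomial.induction_on with
  | C c => simp [← algebraMap_eq]
  | add q r hq hr => simp only [map_add, hq, hr]
  | mul_X q v hq => simp [fiberSum_X]

lemma DerivVanish.of_fiberSum (m : V → V) (ends : E → V × V) (l : List E)
    {h : MvPolynomial V K} (H : DerivVanish K ends l (fiberSum K m h)) :
    DerivVanish K (Prod.map m m ∘ ends) l h := by
  induction l generalizing h with
  | nil => simpa [DerivVanish, constantCoeff_fiberSum] using H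
  | cons e l ih =>
    refine ⟨ih H.1, ih ?_⟩
    rw [Function.comp_apply, ← edgeDeriv_fiberSum]
    exact H.2

lemma fiberSum_mem_cutIdeal (ends : E → V × V) (e : E) (l : List E) {h : MvPolynomial V K}
    (H : h ∈ cutIdeal K
      (Prod.map (merge (ends e).1 (ends e).2) (merge (ends e).1 (ends e).2) ∘ ends) l) :
    fiberSum K (merge (ends e).1 (ends e).2) h ∈ cutIdeal K ends (e :: l) := by
  rw [← Ideal.mem_comap]
  revert h
  change cutIdeal K _ l ≤ _
  rw [cutIdeal, Ideal.span_le]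
  rintro _ ⟨I, rfl⟩
  rw [SetLike.mem_coe, Ideal.mem_comap, map_pow, fiberSum_sum_X]
  refine pow_mem_cutIdeal ends _ _ ?_
  simp [merge_left, merge_right, cutSize]

lemma X_dvd_sub_fiberSum {a b : V} (hab : a ≠ b) (g : MvPolynomial V K) :
    (X b : MvPolynomial V K) ∣ g - fiberSum K (merge a b)
      (aeval (fun v => (if v = b then 0 else X v : MvPolynomial V K)) g) := by
  induction g using MvPolynomial.induction_on with
  | C c => simp [← algebraMap_eq]
  | add q r hq hr =>
    simp only [map_add, add_sub_add_comm]
    exact dvd_add hq hr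
  | mul_X q v hq =>
    have hv : X b ∣ (X v : MvPolynomial V K) -
        fiberSum K (merge a b) (aeval (fun v => (if v = b then 0 else X v : MvPolynomial V K))
          (X v : MvPolynomial V K)) := by
      rw [aeval_X]
      by_cases hvb : v = b
      · simp [hvb]
      · rw [if_neg hvb, fiberSum_X]
        by_cases hva : v = a
        · have : ({w | merge a b w = v} : Finset V) = {a, b} := by
            ext w
            by_cases hw : w = b <;> simp [merge, hw, hva]
          rw [this, Finset.sum_pair hab, hva]
          simp
        · have : ({w | merge a b w = v} : Finset V) = {v} := by
            ext w
            simp only [Finset.mem_filter, Finset.mem_univ, true_and, Finset.mem_singleton]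
            by_cases hw : w = b
            · simp [merge, hw, Ne.symm hva, Ne.symm hvb]
            · simp [merge, hw]
          simp [this]
    rw [map_mul, map_mul]
    have := dvd_add (hq.mul_right (X v)) (hv.mul_left
      (fiberSum K (merge a b)
        (aeval (fun v => (if v = b then 0 else X v : MvPolynomial V K)) q)))
    convert this using 1
    ring

lemma exists_fiberSum_eq_of_edgeDeriv_eq_zero [CharZero K] {a b : V} (hab : a ≠ b)
    {g : MvPolynomial V K} (hg : edgeDeriv K (a, b) g = 0) :
    ∃ h, fiberSum K (merge a b) h = g := by
  have hb : edgeDeriv K (a, b) (X b) = -1 := by simp [edgeDeriv_X, hab.symm]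
  have key (N : ℕ) : ∀ (c : ℕ) (f : MvPolynomial V K), (edgeDeriv K (a, b))^[N] f = 0 →
      ((c : K) + 1) • f = X b * edgeDeriv K (a, b) f → f = 0 := by
    induction N with
    | zero => intro c f hf _; exact hf
    | succ N ih =>
      intro c f hf hcf
      have hdf : edgeDeriv K (a, b) f = 0 := by
        refine ih (c + 1) _ hf ?_
        have := congrArg (edgeDeriv K (a, b)) hcf
        rw [Derivation.map_smul, Derivation.leibniz, hb] at this
        push_cast
        rw [add_smul, this]
        simp
      rw [hdf, mul_zero] at hcf
      exact (smul_eq_zero.1 hcf).resolve_left (by exact_mod_cast c.succ_ne_zero)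
  obtain ⟨f, hf⟩ := X_dvd_sub_fiberSum hab g
  have hd := congrArg (edgeDeriv K (a, b)) hf
  rw [map_sub, hg, edgeDeriv_fiberSum, Prod.map_apply, merge_left, merge_right, edgeDeriv_self,
    Derivation.leibniz, hb] at hd
  obtain ⟨N, hN⟩ := exists_iterate_edgeDeriv_eq_zero (a, b) f
  have hf0 : f = 0 := by
    refine key N 0 f hN ?_
    simp at hd
    simp
    linear_combination hd
  rw [hf0, mul_zero, sub_eq_zero] at hf
  exact ⟨_, hf.symm⟩

lemma exists_add_fiberSum_eq [CharZero K] (ends : E → V × V) (e : E) (l : List E)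
    (he : (ends e).1 ≠ (ends e).2) {g : MvPolynomial V K}
    (hg : edgeDeriv K (ends e) g ∈ cutIdeal K ends l) :
    ∃ u ∈ cutIdeal K ends (e :: l), ∃ h,
      u + fiberSum K (merge (ends e).1 (ends e).2) h = g := by
  obtain ⟨u, hu, hd⟩ := exists_mem_cutIdeal_edgeDeriv_eq ends e l he hg
  obtain ⟨h, hh⟩ := exists_fiberSum_eq_of_edgeDeriv_eq_zero he (g := g - u)
    (by rw [Prod.mk.eta, map_sub, hd, sub_self])
  exact ⟨u, hu, h, by rw [hh, add_sub_cancel]⟩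

lemma cutIdeal_nil (ends : E → V × V) :
    cutIdeal K ends [] = RingHom.ker (constantCoeff (σ := V) (R := K)) := by
  refine le_antisymm (Ideal.span_le.2 ?_) fun g hg => ?_
  · rintro _ ⟨I, rfl⟩
    simp [cutSize]
  · have hX : Ideal.span (Set.range (X : V → MvPolynomial V K)) ≤ cutIdeal K ends [] := by
      rw [Ideal.span_le]
      rintro _ ⟨v, rfl⟩
      simpa using pow_mem_cutIdeal (K := K) ends [] {v} (k := 1) (by simp [cutSize])
    refine hX ?_
    rw [← Set.image_univ, mem_ideal_span_X_image]
    intro m hm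
    by_contra! hne
    refine mem_support_iff.1 hm ?_
    have : m = 0 := by ext v; simpa using hne v
    rwa [this]

theorem mem_cutIdeal_iff_derivVanish [CharZero K] (ends : E → V × V) (l : List E)
    (g : MvPolynomial V K) : g ∈ cutIdeal K ends l ↔ DerivVanish K ends l g := by
  induction l generalizing ends g with
  | nil => rw [cutIdeal_nil, RingHom.mem_ker, DerivVanish]
  | cons e l ih =>
    refine ⟨fun hg => ⟨(ih ends g).1 (cutIdeal_cons_le ends e l hg),
      (ih ends _).1 (edgeDeriv_mem_cutIdeal ends e l hg)⟩, fun hg => ?_⟩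
    by_cases he : (ends e).1 = (ends e).2
    · rw [cutIdeal_cons_of_loop ends e l he]
      exact (ih ends g).2 hg.1
    · obtain ⟨u, hu, h, rfl⟩ := exists_add_fiberSum_eq ends e l he ((ih ends _).2 hg.2)
      refine add_mem hu (fiberSum_mem_cutIdeal ends e l ((ih _ h).2 (.of_fiberSum _ ends l ?_)))
      rw [← ih ends]
      simpa using sub_mem ((ih ends _).2 hg.1) (cutIdeal_cons_le ends e l hu)

theorem rank_quotient_cutIdeal_cons {V K : Type} [DecidableEq V] [Fintype V] [Field K]
    [CharZero K] (ends : E → V × V) (e : E) (l : List E) (he : (ends e).1 ≠ (ends e).2) :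
    Module.rank K (MvPolynomial V K ⧸ cutIdeal K ends (e :: l)) =
      Module.rank K (MvPolynomial V K ⧸ cutIdeal K ends l) +
      Module.rank K (MvPolynomial V K ⧸ cutIdeal K
        (Prod.map (merge (ends e).1 (ends e).2) (merge (ends e).1 (ends e).2) ∘ ends) l) := by
  set m := merge (ends e).1 (ends e).2
  let J := (cutIdeal K ends (e :: l)).restrictScalars K
  let J₁ := (cutIdeal K ends l).restrictScalars K
  let J₂ := (cutIdeal K (Prod.map m m ∘ ends) l).restrictScalars K
  have hinj (h : MvPolynomial V K) :
      fiberSum K m h ∈ cutIdeal K ends (e :: l) ↔ h ∈ cutIdeal K (Prod.map m m ∘ ends) l := by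
    refine ⟨fun H => ?_, fiberSum_mem_cutIdeal ends e l⟩
    rw [mem_cutIdeal_iff_derivVanish] at H ⊢
    exact .of_fiberSum m ends l H.1
  let d : (MvPolynomial V K ⧸ J) →ₗ[K] (MvPolynomial V K ⧸ J₁) :=
    J.mapQ J₁ (edgeDeriv K (ends e)).toLinearMap
      fun _ hg => edgeDeriv_mem_cutIdeal ends e l hg
  let φ : (MvPolynomial V K ⧸ J₂) →ₗ[K] (MvPolynomial V K ⧸ J) :=
    J₂.mapQ J (fiberSum K m).toLinearMap fun h hh => (hinj h).2 hh
  have hd : Function.Surjective d := by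
    intro q
    obtain ⟨q, rfl⟩ := J₁.mkQ_surjective q
    obtain ⟨g, rfl⟩ := edgeDeriv_surjective he q
    exact ⟨J.mkQ g, rfl⟩
  have hφ : Function.Injective φ := by
    rw [← LinearMap.ker_eq_bot, LinearMap.ker_eq_bot']
    intro q hq
    obtain ⟨q, rfl⟩ := J₂.mkQ_surjective q
    exact (Submodule.Quotient.mk_eq_zero J₂).2
      ((hinj q).1 ((Submodule.Quotient.mk_eq_zero J).1 hq))
  have hker : LinearMap.ker d = LinearMap.range φ := by
    ext q
    obtain ⟨q, rfl⟩ := J.mkQ_surjective q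
    constructor
    · intro hq
      obtain ⟨u, hu, h, rfl⟩ := exists_add_fiberSum_eq ends e l he
        ((Submodule.Quotient.mk_eq_zero J₁).1 hq)
      refine ⟨J₂.mkQ h, ?_⟩
      rw [map_add, Submodule.mkQ_apply J u, (Submodule.Quotient.mk_eq_zero J).2 hu, zero_add]
      rfl
    · rintro ⟨h, hh⟩
      obtain ⟨h, rfl⟩ := J₂.mkQ_surjective h
      rw [← hh]
      refine (Submodule.Quotient.mk_eq_zero J₁).2 ?_
      change edgeDeriv K (ends e) (fiberSum K m h) ∈ cutIdeal K ends l
      have : Prod.map m m (ends e) = ((ends e).1, (ends e).1) := by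
        simp [m, Prod.map, merge_left, merge_right]
      rw [edgeDeriv_fiberSum, this, edgeDeriv_self]
      simp
  have h := LinearMap.rank_range_add_rank_ker d
  rw [hker, rank_range_of_surjective d hd, rank_range_of_injective φ hφ] at h
  exact h.symm

end Contraction

end EdgeLists

section Counting

/-- The unordered endpoints of each edge. -/
def unordered (ends : E → V × V) (e : E) : Sym2 V := s((ends e).1, (ends e).2)

open Classical in
/-- The subforests with edges in `S`. -/
noncomputable def forests (ends : E → Sym2 V) (S : Finset E) : Finset (Finset E) :=
  {A ∈ S.powerset | IsForest ends A}

lemma numComponents_empty (ends : E → Sym2 V) : numComponents ends ∅ = Nat.card V :=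
  Nat.card_congr ⟨Quot.lift id (by simp [edgeRel]), Quot.mk _, by rintro ⟨v⟩; rfl, fun _ => rfl⟩

variable [DecidableEq E]

lemma card_forests_insert (ends : E → Sym2 V) {e : E} {S : Finset E} (heS : e ∉ S) :
    (forests ends (insert e S)).card = (forests ends S).card +
      Nat.card {A : Finset E // A ⊆ S ∧ IsForest ends (insert e A)} := by
  classical
  have hinj : Set.InjOn (insert e) (S.powerset : Set (Finset E)) := by
    intro A hA B hB hAB
    have hA' : e ∉ A := fun h => heS (Finset.mem_powerset.1 hA h)
    have hB' : e ∉ B := fun h => heS (Finset.mem_powerset.1 hB h)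
    rw [← Finset.erase_insert hA', hAB, Finset.erase_insert hB']
  rw [forests, Finset.powerset_insert, Finset.filter_union, Finset.card_union_of_disjoint,
    Finset.filter_image, Finset.card_image_of_injOn
      (hinj.mono fun A hA => (Finset.mem_filter.1 hA).1), ← forests]
  · congr 1
    rw [← Nat.card_eq_finsetCard]
    exact Nat.card_congr (Equiv.subtypeEquivRight fun A => by simp)
  · refine Finset.disjoint_left.2 fun A hA hA' => ?_
    simp only [Finset.mem_filter, Finset.mem_image, Finset.mem_powerset] at hA hA'
    obtain ⟨⟨B, -, rfl⟩, -⟩ := hA'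
    exact heS (hA.1 (Finset.mem_insert_self _ _))

lemma numComponents_insert_of_loop (ends : E → V × V) (e : E) (A : Finset E)
    (he : (ends e).1 = (ends e).2) :
    numComponents (unordered ends) (insert e A) = numComponents (unordered ends) A := by
  refine Nat.card_congr
    ⟨Quot.lift (Quot.mk _) ?_, Quot.lift (Quot.mk _) ?_, by rintro ⟨v⟩; rfl, by rintro ⟨v⟩; rfl⟩
  · rintro v w ⟨f, hf, hfe⟩
    rcases Finset.mem_insert.1 hf with rfl | hf
    · rw [unordered, he, Sym2.eq_iff] at hfe
      rcases hfe with ⟨rfl, h⟩ | ⟨rfl, h⟩ <;> rw [h]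
    · exact Quot.sound ⟨f, hf, hfe⟩
  · rintro v w ⟨f, hf, hfe⟩
    exact Quot.sound ⟨f, Finset.mem_insert_of_mem hf, hfe⟩

variable [DecidableEq V]

lemma numComponents_merge [Fintype V] (ends : E → V × V) (e : E) (A : Finset E)
    (he : (ends e).1 ≠ (ends e).2) :
    numComponents (unordered (Prod.map (merge (ends e).1 (ends e).2)
      (merge (ends e).1 (ends e).2) ∘ ends)) A =
      numComponents (unordered ends) (insert e A) + 1 := by
  obtain ⟨a, b, hab⟩ : ∃ a b, ends e = (a, b) := ⟨_, _, rfl⟩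
  simp only [hab] at he ⊢
  have hmk (v : V) : Quot.mk (edgeRel (unordered ends) (insert e A)) (merge a b v) =
      Quot.mk _ v := by
    by_cases hv : v = b
    · rw [hv, merge_right]
      exact Quot.sound ⟨e, Finset.mem_insert_self _ _, by rw [unordered, hab]⟩
    · rw [merge_of_ne a hv]
  rw [numComponents, numComponents, ← Finite.card_option]
  refine Nat.card_congr
    ⟨Quot.lift (fun v => if v = b then none else some (Quot.mk _ v)) ?_,
      fun o => o.elim (Quot.mk _ b) (Quot.lift (fun v => Quot.mk _ (merge a b v)) ?_), ?_, ?_⟩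
  · rintro v w ⟨f, hf, hfe⟩
    have hsound : Quot.mk (edgeRel (unordered ends) (insert e A)) (ends f).1 =
        Quot.mk _ (ends f).2 :=
      Quot.sound ⟨f, Finset.mem_insert_of_mem hf, rfl⟩
    rw [unordered, Sym2.eq_iff] at hfe
    rcases hfe with ⟨rfl, rfl⟩ | ⟨rfl, rfl⟩ <;> simp [merge_ne he, hmk, hsound]
  · rintro v w ⟨f, hf, hfe⟩
    rw [unordered, Sym2.eq_iff] at hfe
    rcases Finset.mem_insert.1 hf with rfl | hf
    · rw [hab] at hfe
      rcases hfe with ⟨rfl, rfl⟩ | ⟨rfl, rfl⟩ <;> simp only [merge_left, merge_right]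
    · refine Quot.sound ⟨f, hf, ?_⟩
      rw [unordered, Sym2.eq_iff]
      rcases hfe with ⟨rfl, rfl⟩ | ⟨rfl, rfl⟩
      · exact .inl ⟨rfl, rfl⟩
      · exact .inr ⟨rfl, rfl⟩
  · rintro ⟨v⟩
    by_cases hv : v = b
    · simp [hv]
    · simp [hv, merge_of_ne]
  · rintro (_ | q)
    · simp
    · obtain ⟨v⟩ := q
      simp only [Option.elim_some]
      rw [if_neg (merge_ne he v), hmk]

lemma card_le_card_add_numComponents [Fintype V] (ends : E → V × V) (A : Finset E) :
    Nat.card V ≤ A.card + numComponents (unordered ends) A := by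
  induction A using Finset.induction_on generalizing ends with
  | empty => simp [numComponents_empty]
  | insert e A heA ih =>
    rw [Finset.card_insert_of_notMem heA]
    by_cases he : (ends e).1 = (ends e).2
    · rw [numComponents_insert_of_loop ends e A he]
      have := ih ends
      omega
    · have := ih (Prod.map (merge (ends e).1 (ends e).2) (merge (ends e).1 (ends e).2) ∘ ends)
      rw [numComponents_merge ends e A he] at this
      omega

lemma not_isForest_insert_of_loop [Fintype V] (ends : E → V × V) (e : E) (A : Finset E)
    (heA : e ∉ A) (he : (ends e).1 = (ends e).2) :
    ¬ IsForest (unordered ends) (insert e A) := by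
  have := card_le_card_add_numComponents ends A
  rw [IsForest, Finset.card_insert_of_notMem heA, numComponents_insert_of_loop ends e A he]
  omega

lemma isForest_insert_iff [Fintype V] (ends : E → V × V) (e : E) (A : Finset E)
    (heA : e ∉ A) (he : (ends e).1 ≠ (ends e).2) :
    IsForest (unordered ends) (insert e A) ↔ IsForest (unordered
      (Prod.map (merge (ends e).1 (ends e).2) (merge (ends e).1 (ends e).2) ∘ ends)) A := by
  rw [IsForest, IsForest, Finset.card_insert_of_notMem heA, numComponents_merge ends e A he]
  omega

end Counting

theorem rank_quotient_cutIdeal {V E K : Type} [DecidableEq V] [Fintype V] [DecidableEq E]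
    [Field K] [CharZero K] (ends : E → V × V) (l : List E) (hl : l.Nodup) :
    Module.rank K (MvPolynomial V K ⧸ cutIdeal K ends l) =
      (forests (unordered ends) l.toFinset).card := by
  induction l generalizing ends with
  | nil =>
    have h1 : (forests (unordered ends) ([] : List E).toFinset).card = 1 := by
      rw [Finset.card_eq_one]
      refine ⟨∅, ?_⟩
      ext A
      simp only [forests, List.toFinset_nil, Finset.powerset_empty, Finset.mem_filter,
        Finset.mem_singleton, and_iff_left_iff_imp]
      rintro rfl
      simp [IsForest, numComponents_empty]
    have e := (Ideal.quotientKerAlgEquivOfSurjective (R₁ := K)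
      (f := (aeval (fun _ => 0) : MvPolynomial V K →ₐ[K] K))
      fun c => ⟨C c, by simp [← algebraMap_eq]⟩).toLinearEquiv
    rw [h1, Nat.cast_one, ← Module.rank_self K, ← e.rank_eq]
    refine congrArg (fun J : Ideal (MvPolynomial V K) => Module.rank K (MvPolynomial V K ⧸ J)) ?_
    rw [cutIdeal_nil]
    ext g
    simp [RingHom.mem_ker, constantCoeff_eq]

  | cons e l ih =>
    obtain ⟨hel, hl⟩ := List.nodup_cons.1 hl
    have hel' : e ∉ l.toFinset := by simpa using hel
    rw [List.toFinset_cons, card_forests_insert _ hel']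
    by_cases he : (ends e).1 = (ends e).2
    · have : IsEmpty {A : Finset E // A ⊆ l.toFinset ∧
          IsForest (unordered ends) (insert e A)} :=
        ⟨fun A => not_isForest_insert_of_loop ends e A.1 (fun h => hel' (A.2.1 h)) he A.2.2⟩
      rw [cutIdeal_cons_of_loop ends e l he, ih ends hl, Nat.card_of_isEmpty, add_zero]
    · rw [rank_quotient_cutIdeal_cons ends e l he, ih _ hl, ih _ hl, Nat.cast_add,
        ← Nat.card_eq_finsetCard (forests (unordered (Prod.map (merge _ _) _ ∘ ends)) _)]
      congr 2
      refine Nat.card_congr (Equiv.subtypeEquivRight fun A => ?_)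
      simp only [forests, Finset.mem_filter, Finset.mem_powerset]
      exact and_congr_right fun h => (isForest_insert_iff ends e A (fun h' => hel' (h h')) he).symm

lemma crossCount_unordered {n : ℕ} [Fintype E] (ends : E → Fin n × Fin n) (I : Finset (Fin n)) :
    crossCount (unordered ends) I = cutSize ends Finset.univ.toList I := by
  classical
  rw [crossCount, cutSize, List.countP_eq_length_filter, ← List.toFinset_card_of_nodup
    ((Finset.nodup_toList _).filter _), Set.ncard_eq_toFinset_card']
  congr 1
  ext e
  simp [unordered]
  tauto

lemma forestIdeal_unordered {n : ℕ} [Fintype E] (K : Type*) [Field K]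
    (ends : E → Fin n × Fin n) :
    forestIdeal K 1 (unordered ends) = cutIdeal K ends Finset.univ.toList := by
  refine le_antisymm (Ideal.span_le.2 ?_) (Ideal.span_le.2 ?_)
  · rintro _ ⟨I, -, rfl⟩
    rw [one_mul, crossCount_unordered]
    exact Ideal.subset_span ⟨I, rfl⟩
  · rintro _ ⟨I, rfl⟩
    rcases I.eq_empty_or_nonempty with rfl | hI
    · simp
    · refine Ideal.subset_span ⟨I, hI, ?_⟩
      rw [one_mul, crossCount_unordered]

/-- For a finite multigraph `G` (vertices `1,…,n`, edges `E`
with endpoint map `ends`) and a field `K` of characteristic `0`, the total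
dimension of `B_G^{F_1}` over `K` equals the number of subforests of `G`. -/
theorem dim_B_F1_eq_card_subforests {n : ℕ} {E : Type} [Fintype E]
    (ends : E → Sym2 (Fin n)) (K : Type) [Field K] [CharZero K] :
    Module.finrank K (MvPolynomial (Fin n) K ⧸ forestIdeal K 1 ends)
      = Nat.card {A : Finset E // IsForest ends A} := by
  classical
  obtain ⟨ends, rfl⟩ : ∃ ends' : E → Fin n × Fin n, unordered ends' = ends := by
    have (e : E) : ∃ p : Fin n × Fin n, s(p.1, p.2) = ends e := by
      induction ends e with | _ a b => exact ⟨(a, b), rfl⟩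
    choose f hf using this
    exact ⟨f, funext hf⟩
  rw [forestIdeal_unordered, Module.finrank,
    rank_quotient_cutIdeal ends _ (Finset.nodup_toList _), Cardinal.toNat_natCast,
    ← Nat.card_eq_finsetCard]
  exact Nat.card_congr (Equiv.subtypeEquivRight fun A => by simp [forests])

end ForestAlg
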